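/- For every fixed natural number n ≥ 1, the ratio p_n^(k) / p_k^(k) tends to 0 as k → ∞. -/

import Mathlib

open Real Filter

/-- `nthPrime n` is the `n`-th prime number, 1-indexed: `nthPrime 1 = 2`, `nthPrime 2 = 3`, … -/
noncomputable def nthPrime (n : ℕ) : ℕ := Nat.nth Nat.Prime (n - 1)

/-- `iterPrime n k` is the `k`-fold iterated prime `p_n^(k)`:
`iterPrime n 0 = n`, `iterPrime n 1 = p_n`, and `iterPrime n (k+1) = p_{iterPrime n k}`. -/
noncomputable def iterPrime (n : ℕ) : ℕ → ℕ
  | 0 => n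
  | k + 1 => nthPrime (iterPrime n k)

theorem nthPrime_monotone : Monotone nthPrime := fun _ _ h =>
  Nat.nth_monotone Nat.infinite_setOfPred_prime (Nat.sub_le_sub_right h 1)

theorem lt_nthPrime (n : ℕ) : n < nthPrime n := by
  have h : n - 1 + 2 ≤ nthPrime n := Nat.add_two_le_nth_prime (n - 1)
  omega

theorem primeCounting_nthPrime {n : ℕ} (hn : 1 ≤ n) : Nat.primeCounting (nthPrime n) = n := by
  have h := Nat.count_nth_succ_of_infinite Nat.infinite_setOfPred_prime (n - 1)
  rw [Nat.sub_add_cancel hn] at h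
  exact h

theorem iterPrime_monotone (k : ℕ) : Monotone fun n => iterPrime n k := by
  induction k with
  | zero => exact monotone_id
  | succ k ih => exact nthPrime_monotone.comp ih

theorem iterPrime_nthPrime (n k : ℕ) : iterPrime (nthPrime n) k = nthPrime (iterPrime n k) := by
  induction k with
  | zero => rfl
  | succ k ih => exact congrArg nthPrime ih

theorem le_iterPrime (n k : ℕ) : k ≤ iterPrime n k := by
  induction k with
  | zero => exact Nat.zero_le _
  | succ k ih => exact Nat.succ_le_of_lt (ih.trans_lt (lt_nthPrime _))

theorem tendsto_div_nthPrime :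
    Tendsto (fun m : ℕ => (m : ℝ) / (nthPrime m : ℝ)) atTop (nhds 0) := by
  have hp : Tendsto (fun m : ℕ => (nthPrime m : ℝ)) atTop atTop :=
    tendsto_natCast_atTop_atTop.comp
      (tendsto_atTop_mono (fun m => (lt_nthPrime m).le) tendsto_id)
  have hlog : Tendsto (fun m : ℕ => (log 4 + 1) / log (nthPrime m)) atTop (nhds 0) :=
    tendsto_const_nhds.div_atTop (tendsto_log_atTop.comp hp)
  refine tendsto_of_tendsto_of_tendsto_of_le_of_le' tendsto_const_nhds hlog
    (Eventually.of_forall fun m => by positivity) ?_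
  filter_upwards [hp.eventually (Chebyshev.eventually_primeCounting_le one_pos),
    eventually_ge_atTop 1] with m hm h1
  rw [Nat.floor_natCast, primeCounting_nthPrime h1] at hm
  have hpos : (0 : ℝ) < nthPrime m := by exact_mod_cast (Nat.zero_le m).trans_lt (lt_nthPrime m)
  rwa [div_le_iff₀ hpos, div_mul_eq_mul_div]

theorem tendsto_iterPrime_div_diag (n : ℕ) (hn : 1 ≤ n) :
    Filter.Tendsto (fun k : ℕ => (iterPrime n k : ℝ) / (iterPrime k k : ℝ))
      Filter.atTop (nhds 0) := by
  have hlim := tendsto_div_nthPrime.comp (tendsto_atTop_mono (le_iterPrime n) tendsto_id)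
  refine tendsto_of_tendsto_of_tendsto_of_le_of_le' tendsto_const_nhds hlim
    (Eventually.of_forall fun k => by positivity) ?_
  filter_upwards [eventually_ge_atTop (nthPrime n)] with k hk
  have hle : nthPrime (iterPrime n k) ≤ iterPrime k k :=
    iterPrime_nthPrime n k ▸ iterPrime_monotone k hk
  have hpos : (0 : ℝ) < nthPrime (iterPrime n k) := by
    exact_mod_cast (Nat.zero_le _).trans_lt (lt_nthPrime _)
  exact div_le_div_of_nonneg_left (Nat.cast_nonneg _) hpos (by exact_mod_cast hle)
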